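/- Let I be a cofinite ideal of O₀ and let S_I := {c ∈ D : ⟨g, c⟩ = 0 for all g ∈ I}. Then the pairing induces a ℂ-linear isomorphism from S_I onto the dual space (O₀/I)* : the map sending c ∈ S_I to the linear functional on O₀/I induced by g ↦ ⟨g, c⟩ is well defined and bijective. -/

import Mathlib

open Filter Topology

noncomputable section

namespace PaleyWiener

/-- The `ℂ`-algebra structure on germs of `ℂ`-valued functions, via constant germs. -/
instance germAlgebra {α : Type*} {l : Filter α} : Algebra ℂ (Filter.Germ l ℂ) :=
  Algebra.ofModule
    (fun c x y => by
      refine x.inductionOn fun f => y.inductionOn fun g => ?_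
      rw [← Filter.Germ.coe_smul, ← Filter.Germ.coe_mul, ← Filter.Germ.coe_mul,
        ← Filter.Germ.coe_smul, smul_mul_assoc])
    (fun c x y => by
      refine x.inductionOn fun f => y.inductionOn fun g => ?_
      rw [← Filter.Germ.coe_smul, ← Filter.Germ.coe_mul, ← Filter.Germ.coe_mul,
        ← Filter.Germ.coe_smul, mul_smul_comm])

variable (n : ℕ)

/-- The ring of germs at `0` of holomorphic functions on `ℂⁿ`, realized as the subalgebra of
`Filter.Germ (𝓝 0) ℂ` of germs admitting a representative analytic at `0`. -/
def O0 : Subalgebra ℂ (Filter.Germ (𝓝 (0 : Fin n → ℂ)) ℂ) where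
  carrier := {g | ∃ f : (Fin n → ℂ) → ℂ, AnalyticAt ℂ f 0 ∧ g = ↑f}
  mul_mem' := by
    rintro a b ⟨f, hf, rfl⟩ ⟨g, hg, rfl⟩
    exact ⟨f * g, hf.mul hg, rfl⟩
  add_mem' := by
    rintro a b ⟨f, hf, rfl⟩ ⟨g, hg, rfl⟩
    exact ⟨f + g, hf.add hg, rfl⟩
  algebraMap_mem' := fun c => ⟨fun _ => c, analyticAt_const, by
    rw [Algebra.algebraMap_eq_smul_one]
    have h : ((fun _ : Fin n → ℂ => c) : (Fin n → ℂ) → ℂ) = c • (1 : (Fin n → ℂ) → ℂ) := by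
      funext x; simp
    rw [h, Filter.Germ.coe_smul, Filter.Germ.coe_one]⟩

/-- Evaluation at `0` of a germ at `𝓝 0`, as a ring homomorphism; this is well defined
since every neighborhood of `0` contains `0`. -/
def germEval0 : Filter.Germ (𝓝 (0 : Fin n → ℂ)) ℂ →+* ℂ where
  toFun g := g.liftOn (fun f => f 0) fun _ _ h => h.self_of_nhds
  map_one' := rfl
  map_mul' a b := a.inductionOn₂ b fun _ _ => rfl
  map_zero' := rfl
  map_add' a b := a.inductionOn₂ b fun _ _ => rfl

/-- Evaluation at `0` on `O₀`. -/
def evalO0 : O0 n →+* ℂ := (germEval0 n).comp ((O0 n).val : O0 n →ₐ[ℂ] _).toRingHom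

/-- The maximal ideal `M` of `O₀`, consisting of the germs vanishing at `0`. -/
def Mideal : Ideal (O0 n) := RingHom.ker (evalO0 n)

end PaleyWiener

namespace PaleyWiener

/-- The partial derivative of `f : ℂⁿ → ℂ` in the `i`-th coordinate direction. -/
def pdi (n : ℕ) (i : Fin n) (f : (Fin n → ℂ) → ℂ) : (Fin n → ℂ) → ℂ :=
  fun x => fderiv ℂ f x (Pi.single i 1)

/-- The iterated partial derivative `∂^α f` of `f : ℂⁿ → ℂ` along the coordinate directions,
for a multi-index `α`. -/
def pdMulti (n : ℕ) (α : Fin n →₀ ℕ) (f : (Fin n → ℂ) → ℂ) : (Fin n → ℂ) → ℂ :=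
  (List.finRange n).foldr (fun i g => (pdi n i)^[α i] g) f

theorem O0_exists {n : ℕ} (g : O0 n) :
    ∃ f : (Fin n → ℂ) → ℂ, AnalyticAt ℂ f 0 ∧
      (g : Filter.Germ (nhds (0 : Fin n → ℂ)) ℂ) = ↑f :=
  g.2

/-- A representative, analytic at `0`, of a germ in `O₀`. -/
def rep {n : ℕ} (g : O0 n) : (Fin n → ℂ) → ℂ :=
  Classical.choose (O0_exists g)

/-- The pairing `c ↦ ⟨g, c⟩ = Σ_α c_α (∂^α f)(0)` of a germ `g ∈ O₀` (with analytic
representative `f`) against finitely supported families `c : (Fin n →₀ ℕ) →₀ ℂ`, as a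
`ℂ`-linear map in `c`.  The value is independent of the chosen representative. -/
def pairingL (n : ℕ) (g : O0 n) : ((Fin n →₀ ℕ) →₀ ℂ) →ₗ[ℂ] ℂ :=
  Finsupp.linearCombination ℂ (fun α => pdMulti n α (rep g) 0)

/-- The annihilator `S_I ⊆ D` of an ideal `I ⊴ O₀` with respect to the pairing. -/
def SI (n : ℕ) (I : Ideal (O0 n)) : Submodule ℂ ((Fin n →₀ ℕ) →₀ ℂ) :=
  ⨅ (g : O0 n) (_ : g ∈ I), LinearMap.ker (pairingL n g)

/-- Hadamard's lemma: an analytic function is, near `0`, its value plus a linear combination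
of the coordinates with analytic coefficients. -/
theorem hadamard {n : ℕ} {f : (Fin n → ℂ) → ℂ} (hf : AnalyticAt ℂ f 0) :
    ∃ h : Fin n → (Fin n → ℂ) → ℂ, (∀ i, AnalyticAt ℂ (h i) 0) ∧
      ∀ᶠ z in 𝓝 (0 : Fin n → ℂ), f z = f 0 + ∑ i, z i * h i z := by
  obtain ⟨p, r, hp⟩ := hf
  have hr : 0 < p.shift.radius := by
    rw [p.radius_shift]; exact hp.r_pos.trans_le hp.r_le
  have hs := p.shift.hasFPowerSeriesOnBall hr
  refine ⟨fun i z => p.shift.sum z (Pi.single i 1), fun i => ?_, ?_⟩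
  · exact ((ContinuousLinearMap.apply ℂ ℂ (Pi.single i (1 : ℂ) : Fin n → ℂ)).analyticAt _).comp
      hs.analyticAt
  · have h1 : Metric.eball (0 : Fin n → ℂ) r ∈ 𝓝 0 := Metric.eball_mem_nhds _ hp.r_pos
    have h2 : Metric.eball (0 : Fin n → ℂ) p.shift.radius ∈ 𝓝 0 := Metric.eball_mem_nhds _ hr
    filter_upwards [h1, h2] with z hz1 hz2
    have e1 := hp.hasSum hz1
    have e2 := hs.hasSum hz2
    rw [zero_add] at e1 e2
    have e3 := ((ContinuousLinearMap.apply ℂ ℂ z).hasSum e2)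
    have e4 := (hasSum_nat_add_iff' 1).2 e1
    have e5 : f z - f 0 = p.shift.sum z z := by
      have h0 : ∑ i ∈ Finset.range 1, (p i fun _ => z) = f 0 := by
        simp [← hp.coeff_zero (fun _ => z)]
      rw [h0] at e4
      refine e4.unique ?_
      change HasSum _ ((ContinuousLinearMap.apply ℂ ℂ z) (p.shift.sum z))
      refine (congrArg (fun u => HasSum u _) (funext fun m => ?_)).mpr e3
      change _ = (p m.succ).curryRight (fun _ => z) z
      rw [ContinuousMultilinearMap.curryRight_apply]
      congr 1
      ext j
      refine Fin.lastCases ?_ (fun j => ?_) j <;> simp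
    have e6 : p.shift.sum z z = ∑ i, z i * p.shift.sum z (Pi.single i 1) := by
      have hz : z = ∑ i, z i • (Pi.single i (1 : ℂ) : Fin n → ℂ) := by
        ext j; simp [Finset.sum_apply, Pi.single_apply]
      generalize p.shift.sum z = L
      conv_lhs => rw [hz]
      rw [map_sum]
      refine Finset.sum_congr rfl fun i _ => ?_
      rw [map_smul, smul_eq_mul]
    rw [← e6, ← e5]; ring

theorem analyticAt_pdi {n : ℕ} (i : Fin n) {f : (Fin n → ℂ) → ℂ} (hf : AnalyticAt ℂ f 0) :
    AnalyticAt ℂ (pdi n i f) 0 :=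
  ((ContinuousLinearMap.apply ℂ ℂ (Pi.single i (1 : ℂ) : Fin n → ℂ)).analyticAt _).comp hf.fderiv

theorem pdi_congr {n : ℕ} (i : Fin n) {f g : (Fin n → ℂ) → ℂ} (h : f =ᶠ[𝓝 0] g) :
    pdi n i f =ᶠ[𝓝 0] pdi n i g := by
  filter_upwards [h.fderiv (𝕜 := ℂ)] with z hz
  simp [pdi, hz]

/-- The germ of an analytic function. -/
def mkO {n : ℕ} (f : (Fin n → ℂ) → ℂ) (hf : AnalyticAt ℂ f 0) : O0 n :=
  ⟨(f : Filter.Germ (𝓝 (0 : Fin n → ℂ)) ℂ), f, hf, rfl⟩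

theorem mkO_eq {n : ℕ} {f g : (Fin n → ℂ) → ℂ} {hf : AnalyticAt ℂ f 0} {hg : AnalyticAt ℂ g 0} :
    mkO f hf = mkO g hg ↔ f =ᶠ[𝓝 0] g := by
  rw [← Filter.Germ.coe_eq]
  exact Subtype.ext_iff

theorem rep_an {n : ℕ} (g : O0 n) : AnalyticAt ℂ (rep g) 0 :=
  (Classical.choose_spec (O0_exists g)).1

theorem mkO_rep {n : ℕ} (g : O0 n) : mkO (rep g) (rep_an g) = g :=
  Subtype.ext (Classical.choose_spec (O0_exists g)).2.symm

theorem rep_mkO {n : ℕ} (f : (Fin n → ℂ) → ℂ) (hf : AnalyticAt ℂ f 0) :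
    rep (mkO f hf) =ᶠ[𝓝 0] f :=
  mkO_eq.1 (mkO_rep (mkO f hf))

theorem mkO_add {n : ℕ} {f g : (Fin n → ℂ) → ℂ} (hf : AnalyticAt ℂ f 0) (hg : AnalyticAt ℂ g 0) :
    mkO f hf + mkO g hg = mkO (f + g) (hf.add hg) := rfl

theorem mkO_mul {n : ℕ} {f g : (Fin n → ℂ) → ℂ} (hf : AnalyticAt ℂ f 0) (hg : AnalyticAt ℂ g 0) :
    mkO f hf * mkO g hg = mkO (f * g) (hf.mul hg) := rfl

theorem mkO_smul {n : ℕ} {f : (Fin n → ℂ) → ℂ} (c : ℂ) (hf : AnalyticAt ℂ f 0) :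
    c • mkO f hf = mkO (c • f) hf.const_smul := rfl

theorem mkO_one {n : ℕ} : (1 : O0 n) = mkO (fun _ => 1) analyticAt_const := rfl

theorem evalO0_mkO {n : ℕ} {f : (Fin n → ℂ) → ℂ} (hf : AnalyticAt ℂ f 0) :
    evalO0 n (mkO f hf) = f 0 := rfl

theorem evalO0_smul {n : ℕ} (c : ℂ) (g : O0 n) : evalO0 n (c • g) = c * evalO0 n g := by
  rw [← mkO_rep g, mkO_smul, evalO0_mkO, evalO0_mkO]; rfl

/-- The partial derivative on germs, as a function. -/
def dfun {n : ℕ} (i : Fin n) (g : O0 n) : O0 n := mkO (pdi n i (rep g)) (analyticAt_pdi i (rep_an g))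

theorem dfun_mkO {n : ℕ} (i : Fin n) {f : (Fin n → ℂ) → ℂ} (hf : AnalyticAt ℂ f 0) :
    dfun i (mkO f hf) = mkO (pdi n i f) (analyticAt_pdi i hf) :=
  mkO_eq.2 (pdi_congr i (rep_mkO f hf))

/-- The partial derivative on germs, as a linear map. -/
def dlin {n : ℕ} (i : Fin n) : O0 n →ₗ[ℂ] O0 n where
  toFun := dfun i
  map_add' a b := by
    rw [← mkO_rep a, ← mkO_rep b, mkO_add, dfun_mkO, dfun_mkO, dfun_mkO, mkO_add, mkO_eq]
    filter_upwards [(rep_an a).eventually_analyticAt, (rep_an b).eventually_analyticAt] with z h1 h2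
    simp only [pdi, Pi.add_apply]
    rw [fderiv_add h1.differentiableAt h2.differentiableAt]; rfl
  map_smul' c a := by
    rw [RingHom.id_apply, ← mkO_rep a, mkO_smul, dfun_mkO, dfun_mkO, mkO_smul, mkO_eq]
    filter_upwards [(rep_an a).eventually_analyticAt] with z h1
    simp only [pdi, Pi.smul_apply]
    rw [fderiv_const_smul h1.differentiableAt]; rfl

/-- The partial derivative on germs, as a derivation. -/
def dO {n : ℕ} (i : Fin n) : Derivation ℂ (O0 n) (O0 n) :=
  Derivation.mk' (dlin i) fun a b => by
    change dfun i (a * b) = a * dfun i b + b * dfun i a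
    rw [← mkO_rep a, ← mkO_rep b, mkO_mul, dfun_mkO, dfun_mkO, dfun_mkO, mkO_mul, mkO_mul, mkO_add,
      mkO_eq]
    filter_upwards [(rep_an a).eventually_analyticAt, (rep_an b).eventually_analyticAt] with z h1 h2
    simp only [pdi, Pi.add_apply, Pi.mul_apply]
    rw [fderiv_mul h1.differentiableAt h2.differentiableAt]; simp

theorem dO_apply {n : ℕ} (i : Fin n) (g : O0 n) : dO i g = dfun i g := rfl

theorem analyticAt_coord {n : ℕ} (i : Fin n) : AnalyticAt ℂ (fun z : Fin n → ℂ => z i) 0 :=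
  (ContinuousLinearMap.proj (R := ℂ) (φ := fun _ : Fin n => ℂ) i).analyticAt 0

/-- The coordinate germs. -/
def zO {n : ℕ} (i : Fin n) : O0 n :=
  mkO (fun z => z i) (analyticAt_coord i)

theorem dO_zO {n : ℕ} (i j : Fin n) : dO i (zO j) = (Pi.single i 1 : Fin n → O0 n) j := by
  rw [dO_apply, zO, dfun_mkO]
  have : pdi n i (fun z => z j) = fun _ => (Pi.single i 1 : Fin n → ℂ) j := by
    funext z
    have := (ContinuousLinearMap.proj (R := ℂ) (φ := fun _ : Fin n => ℂ) j).fderiv (x := z)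
    simp only [pdi]
    change fderiv ℂ (⇑(ContinuousLinearMap.proj (R := ℂ) (φ := fun _ : Fin n => ℂ) j)) z _ = _
    rw [this]; rfl
  simp only [this]
  by_cases h : j = i
  · subst h; simp [mkO_one]
  · simp [h]; rfl

/-- Iterated partial derivatives along a list of coordinates. -/
def dL {n : ℕ} (α : Fin n →₀ ℕ) (l : List (Fin n)) : O0 n →ₗ[ℂ] O0 n :=
  l.foldr (fun i T => (dlin i ^ (α i)).comp T) LinearMap.id

theorem pdi_iter {n : ℕ} (i : Fin n) (k : ℕ) {f : (Fin n → ℂ) → ℂ} (hf : AnalyticAt ℂ f 0) :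
    ∃ h : AnalyticAt ℂ ((pdi n i)^[k] f) 0,
      (dlin i ^ k) (mkO f hf) = mkO _ h := by
  induction k with
  | zero => exact ⟨hf, rfl⟩
  | succ k ih =>
    obtain ⟨h, e⟩ := ih
    simp only [Function.iterate_succ', Function.comp]
    refine ⟨analyticAt_pdi i h, ?_⟩
    rw [pow_succ', Module.End.mul_apply, e]
    exact dfun_mkO i h

theorem dL_mkO {n : ℕ} (α : Fin n →₀ ℕ) (l : List (Fin n)) {f : (Fin n → ℂ) → ℂ}
    (hf : AnalyticAt ℂ f 0) :
    ∃ h : AnalyticAt ℂ (l.foldr (fun i g => (pdi n i)^[α i] g) f) 0, dL α l (mkO f hf) = mkO _ h := by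
  induction l with
  | nil => exact ⟨hf, rfl⟩
  | cons i l ih =>
    obtain ⟨h, e⟩ := ih
    obtain ⟨h', e'⟩ := pdi_iter i (α i) h
    refine ⟨h', ?_⟩
    exact (congrArg (dlin i ^ (α i)) e).trans e'

theorem pdMulti_rep {n : ℕ} (α : Fin n →₀ ℕ) (g : O0 n) :
    pdMulti n α (rep g) 0 = evalO0 n (dL α (List.finRange n) g) := by
  obtain ⟨h, e⟩ := dL_mkO α (List.finRange n) (rep_an g)
  rw [mkO_rep] at e
  rw [e]; rfl

theorem mem_M {n : ℕ} {g : O0 n} : g ∈ Mideal n ↔ evalO0 n g = 0 := Iff.rfl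

theorem zO_mem {n : ℕ} (i : Fin n) : zO i ∈ Mideal n := rfl

theorem isUnit_of_eval {n : ℕ} {g : O0 n} (h : evalO0 n g ≠ 0) : IsUnit g := by
  have ha := rep_an g
  have h0 : rep g 0 ≠ 0 := by
    rw [← mkO_rep g, evalO0_mkO] at h; exact h
  refine IsUnit.of_mul_eq_one (mkO (rep g)⁻¹ (ha.inv h0)) ?_
  nth_rewrite 1 [← mkO_rep g]
  rw [mkO_mul, mkO_one, mkO_eq]
  filter_upwards [ha.continuousAt.eventually_ne h0] with z hz
  simp [hz]

theorem mkO_sum {n : ℕ} (s : Finset (Fin n)) (f : Fin n → (Fin n → ℂ) → ℂ)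
    (hf : ∀ i, AnalyticAt ℂ (f i) 0) :
    ∃ h : AnalyticAt ℂ (fun z => ∑ i ∈ s, f i z) 0, ∑ i ∈ s, mkO (f i) (hf i) = mkO _ h := by
  classical
  induction s using Finset.induction_on with
  | empty => exact ⟨by simpa using analyticAt_const, by simp; rfl⟩
  | insert a s ha ih =>
    obtain ⟨h, e⟩ := ih
    have : (fun z => ∑ i ∈ insert a s, f i z) = f a + fun z => ∑ i ∈ s, f i z := by
      funext z; simp [Finset.sum_insert ha]
    refine ⟨this ▸ (hf a).add h, ?_⟩
    rw [Finset.sum_insert ha, e, mkO_add, mkO_eq, this]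

theorem hadamardO {n : ℕ} (g : O0 n) :
    ∃ h : Fin n → O0 n, g = evalO0 n g • 1 + ∑ i, zO i * h i := by
  obtain ⟨h, ha, he⟩ := hadamard (rep_an g)
  refine ⟨fun i => mkO (h i) (ha i), ?_⟩
  obtain ⟨h', e'⟩ := mkO_sum Finset.univ (fun i z => z i * h i z)
    (fun i => (analyticAt_coord i).mul (ha i))
  have e2 : ∑ i, zO i * mkO (h i) (ha i) = mkO _ h' := e'
  rw [e2]
  nth_rewrite 1 2 [← mkO_rep g]
  rw [evalO0_mkO, mkO_one, mkO_smul, mkO_add, mkO_eq]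
  filter_upwards [he] with z hz
  simp [hz]

theorem exists_poly {n : ℕ} (k : ℕ) (g : O0 n) :
    ∃ p : MvPolynomial (Fin n) ℂ, g - MvPolynomial.aeval zO p ∈ Mideal n ^ k := by
  induction k generalizing g with
  | zero => exact ⟨0, by simp⟩
  | succ k ih =>
    obtain ⟨h, e⟩ := hadamardO g
    choose p hp using fun i => ih (h i)
    refine ⟨MvPolynomial.C (evalO0 n g) + ∑ i, MvPolynomial.X i * p i, ?_⟩
    have : g - MvPolynomial.aeval zO (MvPolynomial.C (evalO0 n g) + ∑ i, MvPolynomial.X i * p i)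
        = ∑ i, zO i * (h i - MvPolynomial.aeval zO (p i)) := by
      nth_rewrite 1 [e]
      simp only [map_add, map_sum, map_mul, MvPolynomial.aeval_X, MvPolynomial.aeval_C,
        Algebra.algebraMap_eq_smul_one, mul_sub, Finset.sum_sub_distrib]
      ring
    rw [this, pow_succ']
    exact Ideal.sum_mem _ fun i _ => Ideal.mul_mem_mul (zO_mem i) (hp i)

theorem exists_pow_le_ker {A B : Type*} [CommRing A] [CommRing B] [Algebra ℂ B]
    (hB : FiniteDimensional ℂ B) (f : A →+* B)
    (hf : Function.Surjective f) (M : Ideal A) (hM : ∀ x ∈ M, ∀ y, IsUnit (x * y + 1)) :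
    ∃ k, ∀ x ∈ M ^ k, f x = 0 := by
  have : IsArtinianRing B := isArtinian_of_tower ℂ inferInstance
  obtain ⟨k, hk⟩ := IsArtinianRing.isNilpotent_jacobson_bot (R := B)
  refine ⟨k, ?_⟩
  have h1 : M.map f ≤ Ideal.jacobson ⊥ := by
    rw [Ideal.map_le_iff_le_comap]
    intro x hx
    rw [Ideal.mem_comap, Ideal.mem_jacobson_bot]
    intro y
    obtain ⟨y, rfl⟩ := hf y
    simpa using (hM x hx y).map f
  have h2 := Ideal.pow_right_mono h1 k
  rw [← Ideal.map_pow] at h2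
  have h3 : (M ^ k).map f ≤ ⊥ := h2.trans hk.le
  rw [Ideal.map_le_iff_le_comap] at h3
  intro x hx
  have := h3 hx
  rwa [Ideal.mem_comap, Ideal.mem_bot] at this

theorem exists_pow_le_gen {A : Type*} [CommRing A] [Algebra ℂ A] (I : Ideal A)
    (hI : FiniteDimensional ℂ (A ⧸ I)) (M : Ideal A) (hM : ∀ x ∈ M, ∀ y, IsUnit (x * y + 1)) :
    ∃ k, M ^ k ≤ I := by
  obtain ⟨k, hk⟩ := exists_pow_le_ker hI (Ideal.Quotient.mk I) Ideal.Quotient.mk_surjective M hM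
  exact ⟨k, fun x hx => Ideal.Quotient.eq_zero_iff_mem.1 (hk x hx)⟩

theorem unit_of_mem {n : ℕ} (x : O0 n) (hx : x ∈ Mideal n) (y : O0 n) : IsUnit (x * y + 1) :=
  isUnit_of_eval (by rw [map_add, map_mul, mem_M.1 hx]; simp)

/-- The linear algebra behind the main theorem. -/
theorem dual_equiv {D A Q : Type*} [AddCommGroup D] [Module ℂ D] [AddCommGroup A] [Module ℂ A]
    [AddCommGroup Q] [Module ℂ Q] (P : D →ₗ[ℂ] Module.Dual ℂ A) (mkI : A →ₗ[ℂ] Q)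
    (hsurj : Function.Surjective mkI) (S : Submodule ℂ D)
    (hS : ∀ c, c ∈ S ↔ ∀ g, mkI g = 0 → P c g = 0) (hP : ∀ c, (∀ g, P c g = 0) → c = 0)
    (hrep : ∀ φ : Module.Dual ℂ Q, ∃ c, P c = φ.comp mkI) :
    ∃ e : S ≃ₗ[ℂ] Module.Dual ℂ Q, ∀ (c : S) (g : A), e c (mkI g) = P c g := by
  let s : Q → A := Function.surjInv hsurj
  have hs : ∀ x, mkI (s x) = x := Function.surjInv_eq hsurj
  have key : ∀ (c : S) (a b : A), mkI a = mkI b → P c a = P c b := by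
    intro c a b hab
    rw [← sub_eq_zero, ← map_sub]
    refine (hS c).1 c.2 _ ?_
    rw [map_sub, hab, sub_self]
  let F : S →ₗ[ℂ] Module.Dual ℂ Q :=
    { toFun := fun c =>
        { toFun := fun x => P c (s x)
          map_add' := fun x y => by
            rw [← map_add]; exact key c _ _ (by rw [map_add, hs, hs, hs])
          map_smul' := fun t x => by
            rw [RingHom.id_apply, ← map_smul]; exact key c _ _ (by rw [map_smul, hs, hs]) }
      map_add' := fun a b => by ext x; simp
      map_smul' := fun t a => by ext x; simp }
  have hF : ∀ (c : S) (g : A), F c (mkI g) = P c g := fun c g => key c _ _ (hs _)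
  have hinj : Function.Injective F := by
    rw [injective_iff_map_eq_zero]
    intro c hc
    refine Subtype.ext (hP _ fun g => ?_)
    rw [← hF, hc]; rfl
  have hsur : Function.Surjective F := by
    intro φ
    obtain ⟨c, hc⟩ := hrep φ
    have hcI : c ∈ S := (hS c).2 fun g hg => by
      rw [hc, LinearMap.comp_apply, hg, map_zero]
    refine ⟨⟨c, hcI⟩, LinearMap.ext fun x => ?_⟩
    obtain ⟨g, rfl⟩ := hsurj x
    rw [hF, hc]; rfl
  exact ⟨LinearEquiv.ofBijective F ⟨hinj, hsur⟩, fun c g => hF c g⟩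

theorem dO_mem {n : ℕ} (i : Fin n) (k : ℕ) {g : O0 n} (hg : g ∈ Mideal n ^ (k + 1)) :
    dO i g ∈ Mideal n ^ k := by
  induction k generalizing g with
  | zero => simp
  | succ k ih =>
    rw [pow_succ] at hg
    refine Submodule.mul_induction_on hg (fun a ha b hb => ?_) (fun a b ha hb => ?_)
    · rw [Derivation.leibniz, smul_eq_mul, smul_eq_mul]
      refine Ideal.add_mem _ (Ideal.mul_mem_right _ _ ha) ?_
      rw [pow_succ']
      exact Ideal.mul_mem_mul hb (ih ha)
    · rw [map_add]; exact Ideal.add_mem _ ha hb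

theorem dpow_mem {n : ℕ} (i : Fin n) (j k : ℕ) {g : O0 n} (hg : g ∈ Mideal n ^ (k + j)) :
    (dlin i ^ j) g ∈ Mideal n ^ k := by
  induction j generalizing g with
  | zero => simpa using hg
  | succ j ih =>
    rw [pow_succ, Module.End.mul_apply]
    exact ih (dO_mem i _ hg)

theorem dL_mem {n : ℕ} (α : Fin n →₀ ℕ) (l : List (Fin n)) (k : ℕ) {g : O0 n}
    (hg : g ∈ Mideal n ^ (k + (l.map α).sum)) : dL α l g ∈ Mideal n ^ k := by
  induction l generalizing k with
  | nil => exact hg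
  | cons i l ih =>
    refine dpow_mem i (α i) k (ih (k + α i) ?_)
    rw [List.map_cons, List.sum_cons] at hg
    rwa [add_assoc]

theorem pd_zero_of_mem {n : ℕ} (α : Fin n →₀ ℕ) (k : ℕ) (hα : α.degree < k) {g : O0 n}
    (hg : g ∈ Mideal n ^ k) : pdMulti n α (rep g) 0 = 0 := by
  rw [pdMulti_rep, ← mem_M, ← pow_one (Mideal n)]
  refine dL_mem α _ 1 (Ideal.pow_le_pow_right ?_ hg)
  have : ((List.finRange n).map α).sum = α.degree := by
    rw [Finsupp.degree_eq_sum, ← List.ofFn_eq_map, List.sum_ofFn]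
  omega

theorem dO_aeval {n : ℕ} (i : Fin n) (p : MvPolynomial (Fin n) ℂ) :
    dO i (MvPolynomial.aeval zO p) = MvPolynomial.aeval zO (MvPolynomial.pderiv i p) := by
  induction p using MvPolynomial.induction_on with
  | C a => simp
  | add p q hp hq => simp [hp, hq]
  | mul_X p j hp =>
    rw [map_mul, Derivation.leibniz, Derivation.leibniz, hp, MvPolynomial.aeval_X, dO_zO,
      MvPolynomial.pderiv_X]
    simp only [smul_eq_mul, map_add, map_mul, MvPolynomial.aeval_X]
    by_cases h : j = i
    · subst h; simp
    · simp [h]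

theorem evalO0_aeval {n : ℕ} (p : MvPolynomial (Fin n) ℂ) :
    evalO0 n (MvPolynomial.aeval zO p) = MvPolynomial.coeff 0 p := by
  rw [← MvPolynomial.constantCoeff_eq]
  induction p using MvPolynomial.induction_on with
  | C a =>
    rw [MvPolynomial.aeval_C, Algebra.algebraMap_eq_smul_one, evalO0_smul]; simp
  | add p q hp hq => simp [hp, hq]
  | mul_X p j hp =>
    rw [map_mul, map_mul, MvPolynomial.aeval_X, mem_M.1 (zO_mem j)]; simp

theorem coeff_pderiv_iter {n : ℕ} (i : Fin n) (k : ℕ) (m : Fin n →₀ ℕ) :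
    ∃ C : ℂ, C ≠ 0 ∧ ∀ p : MvPolynomial (Fin n) ℂ,
      MvPolynomial.coeff m ((MvPolynomial.pderiv i)^[k] p) =
        C * MvPolynomial.coeff (m + Finsupp.single i k) p := by
  induction k generalizing m with
  | zero => exact ⟨1, one_ne_zero, by simp⟩
  | succ k ih =>
    obtain ⟨C, hC, h⟩ := ih (m + Finsupp.single i 1)
    refine ⟨C * (m i + 1), mul_ne_zero hC (Nat.cast_add_one_ne_zero _), fun p => ?_⟩
    rw [Function.iterate_succ', Function.comp, MvPolynomial.coeff_pderiv, h, add_assoc,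
      ← Finsupp.single_add, add_comm 1 k]
    simp
    try ring

theorem dpow_aeval {n : ℕ} (i : Fin n) (k : ℕ) (p : MvPolynomial (Fin n) ℂ) :
    (dlin i ^ k) (MvPolynomial.aeval zO p) =
      MvPolynomial.aeval zO ((MvPolynomial.pderiv i)^[k] p) := by
  induction k with
  | zero => rfl
  | succ k ih =>
    rw [pow_succ', Module.End.mul_apply, ih, Function.iterate_succ', Function.comp]
    exact dO_aeval i _

theorem dL_aeval {n : ℕ} (α : Fin n →₀ ℕ) (l : List (Fin n)) :
    ∃ T : MvPolynomial (Fin n) ℂ → MvPolynomial (Fin n) ℂ,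
      (∀ p, dL α l (MvPolynomial.aeval zO p) = MvPolynomial.aeval zO (T p)) ∧
      ∀ m, ∃ C : ℂ, C ≠ 0 ∧ ∀ p, MvPolynomial.coeff m (T p) =
        C * MvPolynomial.coeff (m + (l.map fun i => Finsupp.single i (α i)).sum) p := by
  induction l with
  | nil => exact ⟨id, fun p => rfl, fun m => ⟨1, one_ne_zero, by simp⟩⟩
  | cons i l ih =>
    obtain ⟨T, h1, h2⟩ := ih
    refine ⟨fun p => (MvPolynomial.pderiv i)^[α i] (T p), fun p => ?_, fun m => ?_⟩
    · rw [← dpow_aeval, ← h1]; rfl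
    · obtain ⟨C, hC, h⟩ := coeff_pderiv_iter i (α i) m
      obtain ⟨C', hC', h'⟩ := h2 (m + Finsupp.single i (α i))
      refine ⟨C * C', mul_ne_zero hC hC', fun p => ?_⟩
      rw [h, h', List.map_cons, List.sum_cons, mul_assoc, add_assoc]

theorem exists_const {n : ℕ} (α : Fin n →₀ ℕ) :
    ∃ C : ℂ, C ≠ 0 ∧ ∀ p : MvPolynomial (Fin n) ℂ,
      pdMulti n α (rep (MvPolynomial.aeval zO p : O0 n)) 0 = C * MvPolynomial.coeff α p := by
  obtain ⟨T, h1, h2⟩ := dL_aeval α (List.finRange n)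
  obtain ⟨C, hC, h⟩ := h2 0
  refine ⟨C, hC, fun p => ?_⟩
  rw [pdMulti_rep, h1, evalO0_aeval, h, zero_add]
  congr 2
  rw [← List.ofFn_eq_map, List.sum_ofFn]
  exact Finsupp.univ_sum_single α

/-- The pairing as a linear map in the germ. -/
def pairD (n : ℕ) : ((Fin n →₀ ℕ) →₀ ℂ) →ₗ[ℂ] Module.Dual ℂ (O0 n) where
  toFun c :=
    { toFun := fun g => pairingL n g c
      map_add' := fun a b => by
        simp only [pairingL, Finsupp.linearCombination_apply, pdMulti_rep, map_add, smul_add]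
        exact Finsupp.sum_add
      map_smul' := fun t a => by
        simp only [pairingL, Finsupp.linearCombination_apply, pdMulti_rep, map_smul, evalO0_smul,
          smul_eq_mul, RingHom.id_apply, Finsupp.sum, Finset.mul_sum]
        refine Finset.sum_congr rfl fun α _ => ?_
        ring }
  map_add' a b := by ext g; simp
  map_smul' t a := by ext g; simp

theorem pairD_apply (n : ℕ) (c : (Fin n →₀ ℕ) →₀ ℂ) (g : O0 n) : pairD n c g = pairingL n g c := rfl

theorem mem_SI {n : ℕ} {I : Ideal (O0 n)} {c : (Fin n →₀ ℕ) →₀ ℂ} :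
    c ∈ SI n I ↔ ∀ g ∈ I, pairingL n g c = 0 := by
  simp [SI, Submodule.mem_iInf]

theorem pairing_injective {n : ℕ} {c : (Fin n →₀ ℕ) →₀ ℂ} (h : ∀ g, pairingL n g c = 0) : c = 0 := by
  ext α
  have := h (MvPolynomial.aeval zO (MvPolynomial.monomial α (1 : ℂ)))
  obtain ⟨C, hC, hα⟩ := exists_const α
  rw [pairingL, Finsupp.linearCombination_apply, Finsupp.sum, Finset.sum_eq_single α] at this
  · rw [hα] at this
    simpa [hC] using this
  · intro β _ hβ
    obtain ⟨C', -, hβ'⟩ := exists_const β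
    rw [hβ', MvPolynomial.coeff_monomial, if_neg hβ.symm]; simp
  · intro h; simp [Finsupp.notMem_support_iff.1 h]

theorem monomial_mem {n : ℕ} (α : Fin n →₀ ℕ) (k : ℕ) (hk : k ≤ α.degree) :
    MvPolynomial.aeval zO (MvPolynomial.monomial α (1 : ℂ)) ∈ Mideal n ^ k := by
  refine Ideal.pow_le_pow_right hk ?_
  rw [MvPolynomial.aeval_monomial, map_one, one_mul, Finsupp.degree_eq_sum,
    Finsupp.prod_fintype _ _ (by simp), ← Finset.prod_pow_eq_pow_sum]
  exact Ideal.prod_mem_prod fun i _ => Ideal.pow_mem_pow (zO_mem i) _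

theorem exists_rep {n : ℕ} (k : ℕ) (φ : O0 n →ₗ[ℂ] ℂ) (hφ : ∀ g ∈ Mideal n ^ k, φ g = 0) :
    ∃ c, pairD n c = φ := by
  classical
  choose C hC hCp using fun α : Fin n →₀ ℕ => exists_const α
  have hfin : {α : Fin n →₀ ℕ | α.degree < k}.Finite :=
    (Finsupp.finite_of_degree_le k).subset fun α (h : α.degree < k) => h.le
  let c : (Fin n →₀ ℕ) →₀ ℂ := ∑ α ∈ hfin.toFinset, Finsupp.single α
    (φ (MvPolynomial.aeval zO (MvPolynomial.monomial α (1 : ℂ))) / C α)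
  have hc : ∀ g, pairD n c g = ∑ α ∈ hfin.toFinset,
      (φ (MvPolynomial.aeval zO (MvPolynomial.monomial α (1 : ℂ))) / C α) *
        pdMulti n α (rep g) 0 := by
    intro g
    rw [pairD_apply, map_sum]
    simp [pairingL]
  have h0 : ∀ g ∈ Mideal n ^ k, pairD n c g = 0 := by
    intro g hg
    rw [hc]
    refine Finset.sum_eq_zero fun α hα => ?_
    rw [pd_zero_of_mem α k (by simpa using hα) hg, mul_zero]
  have h1 : (pairD n c).comp (MvPolynomial.aeval zO).toLinearMap =
      φ.comp (MvPolynomial.aeval zO : MvPolynomial (Fin n) ℂ →ₐ[ℂ] O0 n).toLinearMap := by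
    refine MvPolynomial.linearMap_ext fun β => LinearMap.ext_ring ?_
    simp only [LinearMap.comp_apply, AlgHom.toLinearMap_apply]
    by_cases hβ : β.degree < k
    · rw [hc, Finset.sum_eq_single β]
      · rw [hCp, MvPolynomial.coeff_monomial, if_pos rfl, mul_one, div_mul_cancel₀ _ (hC β)]
      · intro α _ hα
        rw [hCp, MvPolynomial.coeff_monomial, if_neg hα.symm]; simp
      · intro h; exact absurd (by simpa using hβ) h
    · have := monomial_mem β k (not_lt.1 hβ)
      rw [h0 _ this, hφ _ this]
  refine ⟨c, LinearMap.ext fun g => ?_⟩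
  obtain ⟨p, hp⟩ := exists_poly k g
  have e1 := h0 _ hp
  have e2 := hφ _ hp
  have e3 := LinearMap.congr_fun h1 p
  simp only [LinearMap.comp_apply, AlgHom.toLinearMap_apply] at e3
  rw [map_sub, sub_eq_zero] at e1 e2
  rw [e1, e2, e3]

set_option synthInstance.maxHeartbeats 1000000 in
/-- For a cofinite ideal `I ⊴ O₀`, the pairing induces a `ℂ`-linear
isomorphism from `S_I = {c ∈ D : ⟨g, c⟩ = 0 ∀ g ∈ I}` onto the dual space `(O₀/I)*`:
the map sending `c ∈ S_I` to the linear functional on `O₀/I` induced by `g ↦ ⟨g, c⟩` is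
well defined and bijective. -/
theorem annihilator_linearEquiv_dual_quotient (n : ℕ) (hn : 1 ≤ n) (I : Ideal (O0 n))
    (hI : FiniteDimensional ℂ (O0 n ⧸ I)) :
    ∃ e : SI n I ≃ₗ[ℂ] Module.Dual ℂ (O0 n ⧸ I),
      ∀ (c : SI n I) (g : O0 n), e c (Ideal.Quotient.mk I g) = pairingL n g ↑c := by
  obtain ⟨k, hk⟩ := exists_pow_le_gen I hI (Mideal n) unit_of_mem
  have hker : ∀ g, (Ideal.Quotient.mkₐ ℂ I).toLinearMap g = 0 ↔ g ∈ I := fun g =>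
    Ideal.Quotient.eq_zero_iff_mem
  exact dual_equiv (pairD n) (Ideal.Quotient.mkₐ ℂ I).toLinearMap Ideal.Quotient.mk_surjective
    (SI n I) (fun c => mem_SI.trans (forall_congr' fun g => imp_congr (hker g).symm Iff.rfl))
    (fun c hc => pairing_injective hc)
    (fun φ => exists_rep k _ fun g hg => by
      rw [LinearMap.comp_apply, (hker g).2 (hk hg), map_zero])

end PaleyWiener
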